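/- arXiv:2209.01956 — 4 statements merged into one kernel-verified Lean document; each statement's English description precedes it below -/
import Mathlib

section
/- Under the interactive model with noise condition E[ξ | σ(D,Z)] = 0 a.s., overlap, and D ∈ {0,1} a.s., one has E[(Y − g0(1, Z)) · D / m0(Z)² | σ(Z)] = 0 almost surely. (Equivalently, E[∂_m ψ1(W, θ0^1, ρ0) | Z] = 0, i.e., the partial derivative of the first orthogonal score in the propensity nuisance has zero conditional mean at the true nuisance functions for i = 1.) -/
open MeasureTheory ProbabilityTheory

/-- If `ξ` has zero conditional mean given `m₂`, then any bounded `m₂`-measurable multiple of `ξ`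
has zero conditional mean given every sub-σ-algebra `m₁` of `m₂`. -/
lemma condExp_mul_eq_zero_of_bound {Ω : Type*} {m₁ m₂ m : MeasurableSpace Ω} {P : Measure Ω}
    [IsFiniteMeasure P] (h₁₂ : m₁ ≤ m₂) (hm₂ : m₂ ≤ m) {f ξ : Ω → ℝ}
    (hf : StronglyMeasurable[m₂] f) (hξ : Integrable ξ P) (c : ℝ) (hfc : ∀ᵐ ω ∂P, ‖f ω‖ ≤ c)
    (hξ0 : P[ξ | m₂] =ᵐ[P] 0) : P[f * ξ | m₁] =ᵐ[P] 0 := by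
  have hpull : P[f * ξ | m₂] =ᵐ[P] 0 := by
    filter_upwards [condExp_stronglyMeasurable_mul_of_bound hm₂ hf hξ c hfc, hξ0] with ω h h0
    simp [h, h0]
  calc P[f * ξ | m₁] =ᵐ[P] P[P[f * ξ | m₂] | m₁] := (condExp_condExp_of_le h₁₂ hm₂).symm
    _ =ᵐ[P] P[(0 : Ω → ℝ) | m₁] := condExp_congr_ae hpull
    _ =ᵐ[P] 0 := by rw [condExp_zero]

/-- Under the interactive model with noise condition `E[ξ | σ(D,Z)] = 0` a.s.,
overlap, and `D ∈ {0,1}` a.s., `E[(Y − g0(1, Z)) · D / m0(Z)² | σ(Z)] = 0` almost surely. -/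
theorem stmt_2
    {Ω : Type*} [MeasurableSpace Ω] (P : Measure Ω) [IsProbabilityMeasure P]
    {E : Type*} [MeasurableSpace E]
    (Z : Ω → E) (hZ : Measurable Z)
    (D : Ω → ℝ) (hD : Measurable D) (hD01 : ∀ᵐ ω ∂P, D ω = 0 ∨ D ω = 1)
    (Y : Ω → ℝ) (hY : Integrable Y P)
    (g0 : ℝ × E → ℝ) (hg0 : Measurable g0)
    (m0 : E → ℝ) (hm0 : Measurable m0)
    (hg0int : Integrable (fun ω => g0 (D ω, Z ω)) P)
    (hg1int : Integrable (fun ω => g0 (1, Z ω)) P)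
    (hm0int : Integrable (fun ω => m0 (Z ω)) P)
    (hxi : P[fun ω => Y ω - g0 (D ω, Z ω) |
        MeasurableSpace.comap (fun ω => (D ω, Z ω)) inferInstance] =ᵐ[P] 0)
    (hnu : P[fun ω => D ω - m0 (Z ω) | MeasurableSpace.comap Z inferInstance] =ᵐ[P] 0)
    (ε : ℝ) (hε : ε ∈ Set.Ioo (0 : ℝ) (1 / 2))
    (hover : ∀ᵐ ω ∂P, ε ≤ m0 (Z ω) ∧ m0 (Z ω) ≤ 1 - ε) :
    P[fun ω => (Y ω - g0 (1, Z ω)) * D ω / (m0 (Z ω)) ^ 2 |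
        MeasurableSpace.comap Z inferInstance] =ᵐ[P] 0 := by
  have hDZ : Measurable[MeasurableSpace.comap (fun ω => (D ω, Z ω)) inferInstance]
      (fun ω => (D ω, Z ω)) := comap_measurable _
  have hle : MeasurableSpace.comap Z inferInstance ≤
      MeasurableSpace.comap (fun ω => (D ω, Z ω)) inferInstance :=
    (measurable_snd.comp hDZ).comap_le
  have hweight : Measurable fun p : ℝ × E => p.1 / m0 p.2 ^ 2 := by fun_prop
  have hbound : ∀ᵐ ω ∂P, ‖D ω / m0 (Z ω) ^ 2‖ ≤ 1 / ε ^ 2 := by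
    filter_upwards [hD01, hover] with ω h01 hm
    have hε0 : 0 < ε := hε.1
    have hsq : ε ^ 2 ≤ m0 (Z ω) ^ 2 := by gcongr; exact hm.1
    have hD1 : ‖D ω‖ ≤ 1 := by rcases h01 with h | h <;> simp [h]
    rw [norm_div, norm_pow, Real.norm_eq_abs (m0 _), sq_abs]
    gcongr
  have hzero := condExp_mul_eq_zero_of_bound hle (hD.prodMk hZ).comap_le
    (hweight.comp hDZ).stronglyMeasurable (hY.sub hg0int) (1 / ε ^ 2) hbound hxi
  refine (condExp_congr_ae ?_).trans hzero
  filter_upwards [hD01] with ω h01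
  rcases h01 with h | h <;> simp [h, div_eq_mul_inv, mul_comm]
end

section
/- (Unbiasedness of the first orthogonal score at the truth, i = 1) Under the interactive model with both noise conditions, overlap, and D ∈ {0,1} a.s., the true causal parameter θ0^1 := E[g0(1, Z)] satisfies the moment equation of the score ψ1: E[g0(1, Z) + D · (Y − g0(1, Z)) / m0(Z)] = θ0^1, i.e., E[ψ1(W, θ0^1, ρ0)] = 0. -/
open MeasureTheory ProbabilityTheory

/-- A random variable whose conditional expectation given `m` vanishes is orthogonal to every
`m`-measurable factor for which the product is integrable. -/
theorem integral_mul_eq_zero_of_condExp_eq_zero {Ω : Type*} {m m₀ : MeasurableSpace Ω}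
    {μ : Measure[m₀] Ω} [IsFiniteMeasure μ] (hm : m ≤ m₀) {f g : Ω → ℝ}
    (hf : StronglyMeasurable[m] f) (hfg : Integrable (f * g) μ) (hg : Integrable g μ)
    (h : μ[g | m] =ᵐ[μ] 0) : ∫ ω, f ω * g ω ∂μ = 0 := by
  have hpull : μ[f * g | m] =ᵐ[μ] 0 := by
    filter_upwards [condExp_mul_of_stronglyMeasurable_left hf hfg hg, h] with ω h₁ h₂
    simp [h₁, h₂]
  calc ∫ ω, f ω * g ω ∂μ = ∫ ω, (μ[f * g | m]) ω ∂μ := (integral_condExp hm).symm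
    _ = 0 := by rw [integral_congr_ae hpull]; simp

/-- Unbiasedness of the first orthogonal score at the truth, i = 1: Under the
interactive model with both noise conditions, overlap and `D ∈ {0,1}` a.s.,
`E[g0(1, Z) + D · (Y − g0(1, Z)) / m0(Z)] = E[g0(1, Z)] = θ0^1`. -/
theorem stmt_8
    {Ω : Type*} [MeasurableSpace Ω] (P : Measure Ω) [IsProbabilityMeasure P]
    {E : Type*} [MeasurableSpace E]
    (Z : Ω → E) (hZ : Measurable Z)
    (D : Ω → ℝ) (hD : Measurable D) (hD01 : ∀ᵐ ω ∂P, D ω = 0 ∨ D ω = 1)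
    (Y : Ω → ℝ) (hY : Integrable Y P)
    (g0 : ℝ × E → ℝ) (hg0 : Measurable g0)
    (m0 : E → ℝ) (hm0 : Measurable m0)
    (hg0int : Integrable (fun ω => g0 (D ω, Z ω)) P)
    (hg1int : Integrable (fun ω => g0 (1, Z ω)) P)
    (hm0int : Integrable (fun ω => m0 (Z ω)) P)
    (hxi : P[fun ω => Y ω - g0 (D ω, Z ω) |
        MeasurableSpace.comap (fun ω => (D ω, Z ω)) inferInstance] =ᵐ[P] 0)
    (hnu : P[fun ω => D ω - m0 (Z ω) | MeasurableSpace.comap Z inferInstance] =ᵐ[P] 0)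
    (ε : ℝ) (hε : ε ∈ Set.Ioo (0 : ℝ) (1 / 2))
    (hover : ∀ᵐ ω ∂P, ε ≤ m0 (Z ω) ∧ m0 (Z ω) ≤ 1 - ε) :
    ∫ ω, (g0 (1, Z ω) + D ω * (Y ω - g0 (1, Z ω)) / m0 (Z ω)) ∂P =
      ∫ ω, g0 (1, Z ω) ∂P := by
  have hres : Integrable (fun ω => Y ω - g0 (D ω, Z ω)) P := hY.sub hg0int
  have hprod : Integrable
      (fun ω => D ω / m0 (Z ω) * (Y ω - g0 (D ω, Z ω))) P := by
    refine hres.bdd_mul (c := 1 / ε) (hD.div (hm0.comp hZ)).aestronglyMeasurable ?_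
    filter_upwards [hD01, hover] with ω hDω hm
    have hpos : 0 < m0 (Z ω) := hε.1.trans_le hm.1
    rcases hDω with hDω | hDω
    · simp [hDω, hε.1.le]
    · rw [hDω, Real.norm_of_nonneg (by positivity)]
      exact one_div_le_one_div_of_le hε.1 hm.1
  have hmeas : StronglyMeasurable[MeasurableSpace.comap (fun ω => (D ω, Z ω)) inferInstance]
      (fun ω => D ω / m0 (Z ω)) :=
    ((measurable_fst.div (hm0.comp measurable_snd)).comp
      (comap_measurable (fun ω => (D ω, Z ω)))).stronglyMeasurable
  have hzero := integral_mul_eq_zero_of_condExp_eq_zero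
    (hD.prodMk hZ).comap_le hmeas hprod hres hxi
  have hcongr : (fun ω => g0 (1, Z ω) + D ω * (Y ω - g0 (1, Z ω)) / m0 (Z ω)) =ᵐ[P]
      fun ω => g0 (1, Z ω) + D ω / m0 (Z ω) * (Y ω - g0 (D ω, Z ω)) := by
    filter_upwards [hD01] with ω hDω
    rcases hDω with hDω | hDω <;> simp only [hDω] <;> ring
  rw [integral_congr_ae hcongr, integral_add hg1int hprod, hzero, add_zero]
end

section
/- (Double robustness of ψ1, correctly specified propensity, i = 1) Under the interactive model with both noise conditions, overlap, and D ∈ {0,1} a.s., for every bounded measurable function g : E → ℝ (a possibly misspecified outcome model for the treated), E[g(Z) + D · (Y − g(Z)) / m0(Z)] = E[g0(1, Z)] = θ0^1. That is, the IPW-corrected estimator derived from the score ψ1 remains consistent for θ0^1 even when the outcome model is misspecified, as long as the propensity score m0 is correct. -/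
open MeasureTheory ProbabilityTheory

/-- If `h` has zero conditional expectation given `X`, then it is orthogonal to every measurable
function of `X` for which the product is integrable. -/
theorem integral_comp_mul_eq_zero_of_condExp_comap_eq_zero
    {Ω F : Type*} [MeasurableSpace Ω] [mF : MeasurableSpace F]
    {P : Measure Ω} [IsFiniteMeasure P] {X : Ω → F} (hX : Measurable X)
    {h : Ω → ℝ} (hh : Integrable h P) (hcond : P[h | mF.comap X] =ᵐ[P] 0)
    {φ : F → ℝ} (hφ : Measurable φ) (hint : Integrable (fun ω => φ (X ω) * h ω) P) :
    ∫ ω, φ (X ω) * h ω ∂P = 0 := by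
  have hmeas : StronglyMeasurable[mF.comap X] (fun ω => φ (X ω)) :=
    (hφ.comp (comap_measurable X)).stronglyMeasurable
  have hpull := condExp_mul_of_stronglyMeasurable_left (μ := P) hmeas hint hh
  rw [← integral_condExp hX.comap_le]
  refine integral_eq_zero_of_ae ?_
  filter_upwards [hpull, hcond] with ω h₁ h₂
  have h₃ : (P[fun ω => φ (X ω) * h ω | mF.comap X]) ω = φ (X ω) * (P[h | mF.comap X]) ω := h₁
  rw [h₃, h₂]
  simp

/-- Double robustness of ψ1, correctly specified propensity, i = 1: Under the
interactive model with both noise conditions, overlap and `D ∈ {0,1}` a.s., for every bounded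
measurable `g : E → ℝ`, `E[g(Z) + D · (Y − g(Z)) / m0(Z)] = E[g0(1, Z)] = θ0^1`. -/
theorem stmt_11
    {Ω : Type*} [MeasurableSpace Ω] (P : Measure Ω) [IsProbabilityMeasure P]
    {E : Type*} [MeasurableSpace E]
    (Z : Ω → E) (hZ : Measurable Z)
    (D : Ω → ℝ) (hD : Measurable D) (hD01 : ∀ᵐ ω ∂P, D ω = 0 ∨ D ω = 1)
    (Y : Ω → ℝ) (hY : Integrable Y P)
    (g0 : ℝ × E → ℝ) (hg0 : Measurable g0)
    (m0 : E → ℝ) (hm0 : Measurable m0)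
    (hg0int : Integrable (fun ω => g0 (D ω, Z ω)) P)
    (hg1int : Integrable (fun ω => g0 (1, Z ω)) P)
    (hm0int : Integrable (fun ω => m0 (Z ω)) P)
    (hxi : P[fun ω => Y ω - g0 (D ω, Z ω) |
        MeasurableSpace.comap (fun ω => (D ω, Z ω)) inferInstance] =ᵐ[P] 0)
    (hnu : P[fun ω => D ω - m0 (Z ω) | MeasurableSpace.comap Z inferInstance] =ᵐ[P] 0)
    (ε : ℝ) (hε : ε ∈ Set.Ioo (0 : ℝ) (1 / 2))
    (hover : ∀ᵐ ω ∂P, ε ≤ m0 (Z ω) ∧ m0 (Z ω) ≤ 1 - ε) :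
    ∀ g : E → ℝ, Measurable g → (∃ C : ℝ, ∀ x, |g x| ≤ C) →
      ∫ ω, (g (Z ω) + D ω * (Y ω - g (Z ω)) / m0 (Z ω)) ∂P = ∫ ω, g0 (1, Z ω) ∂P := by
  rintro g hg ⟨C, hC⟩
  obtain ⟨hε0, -⟩ := hε
  have hgZ : Integrable (fun ω => g (Z ω)) P :=
    .of_bound (hg.comp hZ).aestronglyMeasurable C (.of_forall fun ω => hC (Z ω))
  have hDint : Integrable D P := by
    refine .of_bound hD.aestronglyMeasurable 1 ?_
    filter_upwards [hD01] with ω hω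
    rcases hω with h | h <;> simp [h]
  have hξint : Integrable (fun ω => Y ω - g0 (D ω, Z ω)) P := hY.sub hg0int
  have hνint : Integrable (fun ω => D ω - m0 (Z ω)) P := hDint.sub hm0int
  have hT : Integrable (fun ω => D ω / m0 (Z ω) * (Y ω - g0 (D ω, Z ω))) P := by
    refine hξint.bdd_mul (c := 1 / ε) (hD.div (hm0.comp hZ)).aestronglyMeasurable ?_
    filter_upwards [hD01, hover] with ω hω hm
    have hmpos : 0 < m0 (Z ω) := hε0.trans_le hm.1
    rw [Real.norm_eq_abs, abs_div, abs_of_pos hmpos]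
    gcongr
    · rcases hω with h | h <;> simp [h]
    · exact hm.1
  have hS : Integrable
      (fun ω => (g0 (1, Z ω) - g (Z ω)) / m0 (Z ω) * (D ω - m0 (Z ω))) P := by
    have hb : Integrable
        (fun ω => (D ω - m0 (Z ω)) / m0 (Z ω) * (g0 (1, Z ω) - g (Z ω))) P := by
      refine (hg1int.sub hgZ).bdd_mul (c := 1 / ε)
        ((hD.sub (hm0.comp hZ)).div (hm0.comp hZ)).aestronglyMeasurable ?_
      filter_upwards [hD01, hover] with ω hω hm
      have hmpos : 0 < m0 (Z ω) := hε0.trans_le hm.1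
      rw [Real.norm_eq_abs, abs_div, abs_of_pos hmpos]
      gcongr
      · rw [abs_le]
        rcases hω with h | h <;> rw [h] <;> constructor <;> linarith [hm.2]
      · exact hm.1
    refine hb.congr (.of_forall fun ω => ?_)
    ring
  have hT0 : ∫ ω, D ω / m0 (Z ω) * (Y ω - g0 (D ω, Z ω)) ∂P = 0 :=
    integral_comp_mul_eq_zero_of_condExp_comap_eq_zero (hD.prodMk hZ) hξint hxi
      (φ := fun p => p.1 / m0 p.2) (by fun_prop) hT
  have hS0 : ∫ ω, (g0 (1, Z ω) - g (Z ω)) / m0 (Z ω) * (D ω - m0 (Z ω)) ∂P = 0 :=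
    integral_comp_mul_eq_zero_of_condExp_comap_eq_zero hZ hνint hnu
      (φ := fun z => (g0 (1, z) - g z) / m0 z) (by fun_prop) hS
  have hdecomp : (fun ω => g (Z ω) + D ω * (Y ω - g (Z ω)) / m0 (Z ω)) =ᵐ[P]
      fun ω => g0 (1, Z ω) + D ω / m0 (Z ω) * (Y ω - g0 (D ω, Z ω)) +
        (g0 (1, Z ω) - g (Z ω)) / m0 (Z ω) * (D ω - m0 (Z ω)) := by
    filter_upwards [hD01, hover] with ω hω hm
    have hmne : m0 (Z ω) ≠ 0 := (hε0.trans_le hm.1).ne'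
    rcases hω with h | h <;> rw [h] <;> field_simp <;> ring
  rw [integral_congr_ae hdecomp, integral_add (by exact hg1int.add hT) hS, integral_add hg1int hT,
    hT0, hS0]
  simp
end

section
/- (IPW identification of the treated mean) Suppose D ∈ {0,1} a.s., Y = D·Y1 + (1 − D)·Y0 (consistency), the pair (Y0, Y1) is conditionally independent of D given σ(Z) (strong ignorability), and m0(Z) is a version of E[D | σ(Z)] with ε ≤ m0(Z) ≤ 1 − ε a.s. (overlap). If Y0 and Y1 are integrable, then E[D · Y / m0(Z)] = E[Y1] = θ0^1. -/
open MeasureTheory ProbabilityTheory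

/-- Conditionally independent measurable functions are independent under almost every regular
conditional law. -/
lemma ProbabilityTheory.CondIndepFun.ae_indepFun_condExpKernel
    {Ω β γ : Type*} {m mΩ : MeasurableSpace Ω} [StandardBorelSpace Ω]
    {mβ : MeasurableSpace β} {mγ : MeasurableSpace γ}
    [MeasurableSpace.CountableOrCountablyGenerated Ω (β × γ)]
    {hm : m ≤ mΩ} {μ : Measure Ω} [IsFiniteMeasure μ] {f : Ω → β} {g : Ω → γ}
    (h : CondIndepFun m hm f g μ) (hf : Measurable f) (hg : Measurable g) :
    ∀ᵐ ω ∂μ, IndepFun f g (condExpKernel μ m ω) := by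
  filter_upwards [ae_of_ae_trim hm ((condIndepFun_iff_map_prod_eq_prod_map_map hf hg).1 h)]
    with ω hω
  rw [indepFun_iff_map_prod_eq_prod_map_map hf.aemeasurable hg.aemeasurable]
  rwa [Kernel.map_apply _ (hf.prodMk hg), Kernel.prod_apply, Kernel.map_apply _ hf,
    Kernel.map_apply _ hg] at hω

/-- Conditional independence factors the conditional expectation of a product. -/
lemma ProbabilityTheory.CondIndepFun.condExp_mul
    {Ω : Type*} {m mΩ : MeasurableSpace Ω} [StandardBorelSpace Ω] {hm : m ≤ mΩ}
    {μ : Measure Ω} [IsFiniteMeasure μ] {f g : Ω → ℝ} (h : CondIndepFun m hm f g μ)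
    (hf : Integrable f μ) (hg : Integrable g μ) (hfg : Integrable (f * g) μ) :
    μ[f * g | m] =ᵐ[μ] μ[f | m] * μ[g | m] := by
  have hf' := aestronglyMeasurable_trim_condExpKernel hm hf.1
  have hg' := aestronglyMeasurable_trim_condExpKernel hm hg.1
  have hmk : CondIndepFun m hm (hf.1.mk f) (hg.1.mk g) μ := Kernel.IndepFun.congr' h hf' hg'
  filter_upwards [hmk.ae_indepFun_condExpKernel hf.1.stronglyMeasurable_mk.measurable
      hg.1.stronglyMeasurable_mk.measurable, ae_of_ae_trim hm hf', ae_of_ae_trim hm hg',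
    condExp_ae_eq_integral_condExpKernel hm hf, condExp_ae_eq_integral_condExpKernel hm hg,
    condExp_ae_eq_integral_condExpKernel hm hfg] with ω hi h1 h2 e1 e2 e3
  rw [Pi.mul_apply, e1, e2, e3]
  exact (hi.congr h1.symm h2.symm).integral_mul_eq_mul_integral
    ⟨_, hf.1.stronglyMeasurable_mk, h1⟩ ⟨_, hg.1.stronglyMeasurable_mk, h2⟩

/-- IPW identification of the treated mean: Under consistency
`Y = D·Y1 + (1 − D)·Y0`, strong ignorability (`(Y0, Y1)` conditionally independent of `D`
given `σ(Z)`) and overlap, with `m0(Z)` a version of `E[D | σ(Z)]`,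
`E[D · Y / m0(Z)] = E[Y1] = θ0^1`. -/
theorem stmt_16
    {Ω : Type*} [MeasurableSpace Ω] [StandardBorelSpace Ω] [Nonempty Ω]
    (P : Measure Ω) [IsProbabilityMeasure P]
    {E : Type*} [MeasurableSpace E] [StandardBorelSpace E] [Nonempty E]
    (Z : Ω → E) (hZ : Measurable Z)
    (D : Ω → ℝ) (hD : Measurable D) (hD01 : ∀ᵐ ω ∂P, D ω = 0 ∨ D ω = 1)
    (Y0 Y1 : Ω → ℝ) (hY0 : Integrable Y0 P) (hY1 : Integrable Y1 P)
    (Y : Ω → ℝ) (hYdef : ∀ ω, Y ω = D ω * Y1 ω + (1 - D ω) * Y0 ω)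
    (hindep : CondIndepFun (MeasurableSpace.comap Z inferInstance) hZ.comap_le
      (fun ω => (Y0 ω, Y1 ω)) D P)
    (m0 : E → ℝ) (hm0 : Measurable m0)
    (hm0ver : (fun ω => m0 (Z ω)) =ᵐ[P] P[D | MeasurableSpace.comap Z inferInstance])
    (ε : ℝ) (hε : ε ∈ Set.Ioo (0 : ℝ) (1 / 2))
    (hover : ∀ᵐ ω ∂P, ε ≤ m0 (Z ω) ∧ m0 (Z ω) ≤ 1 - ε) :
    ∫ ω, D ω * Y ω / m0 (Z ω) ∂P = ∫ ω, Y1 ω ∂P := by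
  have hm := hZ.comap_le
  have hD1 : ∀ᵐ ω ∂P, ‖D ω‖ ≤ 1 := by
    filter_upwards [hD01] with ω h
    rcases h with h | h <;> simp [h]
  have hDint : Integrable D P := .of_bound hD.aestronglyMeasurable 1 hD1
  have hYD : Integrable (Y1 * D) P := hY1.mul_bdd hD.aestronglyMeasurable hD1
  have hwm : StronglyMeasurable[MeasurableSpace.comap Z inferInstance]
      (fun ω ↦ (m0 (Z ω))⁻¹) :=
    (hm0.inv.comp (comap_measurable Z)).stronglyMeasurable
  have hwb : ∀ᵐ ω ∂P, ‖(m0 (Z ω))⁻¹‖ ≤ ε⁻¹ := by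
    filter_upwards [hover] with ω h
    rw [norm_inv, Real.norm_of_nonneg (hε.1.le.trans h.1)]
    exact inv_anti₀ hε.1 h.1
  have hw : Integrable ((fun ω ↦ (m0 (Z ω))⁻¹) * (Y1 * D)) P :=
    hYD.bdd_mul (hwm.mono hm).aestronglyMeasurable hwb
  have hYD_indep : CondIndepFun (MeasurableSpace.comap Z inferInstance) hm Y1 D P :=
    hindep.comp measurable_snd measurable_id
  calc ∫ ω, D ω * Y ω / m0 (Z ω) ∂P
      = ∫ ω, ((fun ω ↦ (m0 (Z ω))⁻¹) * (Y1 * D)) ω ∂P := by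
        refine integral_congr_ae ?_
        filter_upwards [hD01] with ω h
        rcases h with h | h <;> simp [hYdef, h, div_eq_inv_mul]
    _ = ∫ ω, (P[(fun ω ↦ (m0 (Z ω))⁻¹) * (Y1 * D) |
          MeasurableSpace.comap Z inferInstance]) ω ∂P := (integral_condExp hm).symm
    _ = ∫ ω, (P[Y1 | MeasurableSpace.comap Z inferInstance]) ω ∂P := by
        refine integral_congr_ae ?_
        filter_upwards [condExp_mul_of_stronglyMeasurable_left hwm hw hYD,
          hYD_indep.condExp_mul hY1 hDint hYD, hm0ver, hover] with ω h1 h2 h3 h4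
        have hpos : m0 (Z ω) ≠ 0 := (hε.1.trans_le h4.1).ne'
        rw [h1, Pi.mul_apply, h2, Pi.mul_apply, ← h3]
        field_simp
    _ = ∫ ω, Y1 ω ∂P := integral_condExp hm
end
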